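/- arXiv:2205.00489 — 2 statements merged into one kernel-verified Lean document; each statement's English description precedes it below -/
import Mathlib

section
/- For every n ≥ 0, the oriented diameter of the directed arrowhead AT⃗_n equals 2^n - 1: every element of G_n is a sum of at most 2^n - 1 elements (with repetition) of S⁺, and some element of G_n is not a sum of fewer than 2^n - 1 elements of S⁺. -/
/-- The generating set `S⁺ = {(-1,-1), (1,0), (0,1)}` of the directed arrowhead
digraph, as a subset of `G_n = ZMod (2^n) × ZMod (2^n)`. -/
def Splus (n : ℕ) : Set (ZMod (2 ^ n) × ZMod (2 ^ n)) :=
  {(-1, -1), (1, 0), (0, 1)}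

/-- Directed distance from `(0,0)` to `v` in the Cayley digraph `AT⃗_n = Γ(G_n, S⁺)`:
the least length of a list of elements of `S⁺` (repetitions allowed) summing to `v`. -/
noncomputable def ddistA (n : ℕ) (v : ZMod (2 ^ n) × ZMod (2 ^ n)) : ℕ :=
  sInf {k | ∃ l : List (ZMod (2 ^ n) × ZMod (2 ^ n)),
    l.length = k ∧ (∀ s ∈ l, s ∈ Splus n) ∧ l.sum = v}

/-- The oriented diameter `D⃗_n` of the directed arrowhead digraph `AT⃗_n`. -/
noncomputable def DvecA (n : ℕ) : ℕ := sSup (Set.range (ddistA n))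

lemma arrow_list_exists (n a b c : ℕ) :
    ∃ l : List (ZMod (2 ^ n) × ZMod (2 ^ n)), l.length = a + b + c ∧
      (∀ s ∈ l, s ∈ Splus n) ∧
      l.sum = ((b : ZMod (2 ^ n)) - a, (c : ZMod (2 ^ n)) - a) := by
  refine ⟨List.replicate a (-1, -1) ++ List.replicate b (1, 0) ++ List.replicate c (0, 1),
    by simp [add_assoc], ?_, ?_⟩
  · intro s hs
    simp only [List.mem_append, List.mem_replicate] at hs
    simp only [Splus, Set.mem_insert_iff, Set.mem_singleton_iff]
    tauto
  · simp only [List.sum_append, List.sum_replicate]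
    ext <;> simp <;> ring

lemma arrow_list_counts (n : ℕ) (l : List (ZMod (2 ^ n) × ZMod (2 ^ n)))
    (hl : ∀ s ∈ l, s ∈ Splus n) :
    ∃ a b c : ℕ, l.length = a + b + c ∧
      l.sum = ((b : ZMod (2 ^ n)) - a, (c : ZMod (2 ^ n)) - a) := by
  induction l with
  | nil => exact ⟨0, 0, 0, by simp, by ext <;> simp⟩
  | cons s t ih =>
    obtain ⟨a, b, c, h1, h2⟩ := ih (fun s hs => hl s (List.mem_cons_of_mem _ hs))
    have hs : s ∈ Splus n := hl s List.mem_cons_self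
    simp only [Splus, Set.mem_insert_iff, Set.mem_singleton_iff] at hs
    rcases hs with rfl | rfl | rfl
    · refine ⟨a + 1, b, c, by simp [h1]; omega, ?_⟩
      rw [List.sum_cons, h2]; ext <;> simp <;> ring
    · refine ⟨a, b + 1, c, by simp [h1]; omega, ?_⟩
      rw [List.sum_cons, h2]; ext <;> simp <;> ring
    · refine ⟨a, b, c + 1, by simp [h1]; omega, ?_⟩
      rw [List.sum_cons, h2]; ext <;> simp <;> ring

lemma arrow_not_three (n : ℕ) : ¬ 3 ∣ 2 ^ n := fun h => by
  have := Nat.prime_three.dvd_of_dvd_pow h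
  omega

/-- Numerical upper bound. -/
lemma arrow_num_upper (M x y : ℕ) (h3 : ¬ 3 ∣ M) (hx : x < M) (hy : y < M) :
    ∃ a b c : ℕ, a + b + c ≤ M - 1 ∧ (b = x + a ∨ b + M = x + a) ∧
      (c = y + a ∨ c + M = y + a) := by
  by_cases h0 : x + y ≤ M - 1
  · exact ⟨0, x, y, by omega, by omega, by omega⟩
  rcases le_total x y with h | h
  · by_cases h1 : M + y - 2 * x ≤ M - 1
    · exact ⟨M - x, 0, y - x, by omega, by omega, by omega⟩
    · exact ⟨M - y, M + x - y, 0, by omega, by omega, by omega⟩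
  · by_cases h1 : M + x - 2 * y ≤ M - 1
    · exact ⟨M - y, x - y, 0, by omega, by omega, by omega⟩
    · exact ⟨M - x, 0, M + y - x, by omega, by omega, by omega⟩

lemma arrow_dvd_cases (M z : ℤ) (h : M ∣ z) (h1 : -2 * M < z) (h2 : z < M) :
    z = 0 ∨ z = -M := by
  obtain ⟨k, rfl⟩ := h
  have hM : 0 < M := by linarith
  have hk1 : -2 < k := by nlinarith
  have hk2 : k < 1 := by nlinarith
  have : k = 0 ∨ k = -1 := by omega
  rcases this with rfl | rfl <;> simp

lemma arrow_num_lower (M x y a b c : ℕ) (hM : 0 < M) (h3 : ¬ 3 ∣ M) (hx : x = (M - 1) / 3)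
    (hy : y = M - 1 - x)
    (hb : (M : ℤ) ∣ (b : ℤ) - a - x) (hc : (M : ℤ) ∣ (c : ℤ) - a - y) :
    M - 1 ≤ a + b + c := by
  by_contra hlt
  have := arrow_dvd_cases _ _ hb (by omega) (by omega)
  have := arrow_dvd_cases _ _ hc (by omega) (by omega)
  omega

lemma arrow_upper (n : ℕ) (v : ZMod (2 ^ n) × ZMod (2 ^ n)) :
    ∃ l : List (ZMod (2 ^ n) × ZMod (2 ^ n)),
      l.length ≤ 2 ^ n - 1 ∧ (∀ s ∈ l, s ∈ Splus n) ∧ l.sum = v := by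
  obtain ⟨x, y⟩ := v
  obtain ⟨a, b, c, h, hb, hc⟩ := arrow_num_upper (2 ^ n) x.val y.val (arrow_not_three n)
    (ZMod.val_lt x) (ZMod.val_lt y)
  obtain ⟨l, h1, h2, h3⟩ := arrow_list_exists n a b c
  have key : ∀ (z : ZMod (2 ^ n)) (d : ℕ), (d = z.val + a ∨ d + 2 ^ n = z.val + a) →
      (d : ZMod (2 ^ n)) - a = z := by
    intro z d hd
    have h0 : ((2 ^ n : ℕ) : ZMod (2 ^ n)) = 0 := ZMod.natCast_self _
    have hz : ((z.val : ℕ) : ZMod (2 ^ n)) = z := ZMod.natCast_zmod_val z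
    rcases hd with hd | hd
    · rw [hd, Nat.cast_add, hz]; ring
    · have := congrArg (Nat.cast : ℕ → ZMod (2 ^ n)) hd
      rw [Nat.cast_add, Nat.cast_add, h0, hz, add_zero] at this
      rw [this]; ring
  exact ⟨l, by omega, h2, by rw [h3, key x b hb, key y c hc]⟩

lemma arrow_lower (n : ℕ) : ∃ v : ZMod (2 ^ n) × ZMod (2 ^ n),
    ∀ l : List (ZMod (2 ^ n) × ZMod (2 ^ n)),
      (∀ s ∈ l, s ∈ Splus n) → l.sum = v → 2 ^ n - 1 ≤ l.length := by
  refine ⟨(((2 ^ n - 1) / 3 : ℕ), (2 ^ n - 1 - (2 ^ n - 1) / 3 : ℕ)), fun l hl hs => ?_⟩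
  obtain ⟨a, b, c, h1, h2⟩ := arrow_list_counts n l hl
  rw [h2, Prod.mk.injEq] at hs
  have key : ∀ d x : ℕ, (d : ZMod (2 ^ n)) - a = (x : ZMod (2 ^ n)) →
      ((2 ^ n : ℕ) : ℤ) ∣ (d : ℤ) - a - x := by
    intro d x h
    rw [← ZMod.intCast_zmod_eq_zero_iff_dvd]
    rw [Int.cast_sub, Int.cast_sub, Int.cast_natCast, Int.cast_natCast, Int.cast_natCast, h,
      sub_self]
  rw [h1]
  exact arrow_num_lower (2 ^ n) _ _ a b c (by positivity) (arrow_not_three n) rfl rfl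
    (key _ _ hs.1) (key _ _ hs.2)

/-- The oriented diameter of the directed arrowhead `AT⃗_n` equals `2^n - 1`: every
element of `G_n` is a sum of at most `2^n - 1` elements (with repetition) of `S⁺`,
and some element is not a sum of fewer than `2^n - 1` elements of `S⁺`. -/
theorem directed_arrowhead_diameter (n : ℕ) :
    DvecA n = 2 ^ n - 1 ∧
    (∀ v : ZMod (2 ^ n) × ZMod (2 ^ n), ∃ l : List (ZMod (2 ^ n) × ZMod (2 ^ n)),
      l.length ≤ 2 ^ n - 1 ∧ (∀ s ∈ l, s ∈ Splus n) ∧ l.sum = v) ∧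
    (∃ v : ZMod (2 ^ n) × ZMod (2 ^ n), ∀ l : List (ZMod (2 ^ n) × ZMod (2 ^ n)),
      (∀ s ∈ l, s ∈ Splus n) → l.sum = v → 2 ^ n - 1 ≤ l.length) := by
  refine ⟨?_, arrow_upper n, arrow_lower n⟩
  have hle : ∀ v, ddistA n v ≤ 2 ^ n - 1 := by
    intro v
    obtain ⟨l, h1, h2, h3⟩ := arrow_upper n v
    exact le_trans (Nat.sInf_le ⟨l, rfl, h2, h3⟩) h1
  apply le_antisymm
  · apply csSup_le (Set.range_nonempty _)
    rintro _ ⟨v, rfl⟩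
    exact hle v
  · obtain ⟨v, hv⟩ := arrow_lower n
    have hbdd : BddAbove (Set.range (ddistA n)) :=
      ⟨2 ^ n - 1, by rintro _ ⟨w, rfl⟩; exact hle w⟩
    refine le_trans ?_ (le_csSup hbdd ⟨v, rfl⟩)
    obtain ⟨l, h1, h2, h3⟩ := arrow_upper n v
    unfold ddistA
    refine le_csInf ⟨l.length, l, rfl, h2, h3⟩ ?_
    rintro _ ⟨l', rfl, h2', h3'⟩
    exact hv l' h2' h3'
end

section
/- For every n ≥ 0, the number of elements of G_n whose directed distance from (0,0) in the directed diamond DT⃗_n equals the oriented diameter 2^n - 1 is exactly 2^{n+1} - 1. -/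
/-- The generating set `T⁺ = {(1,1), (1,0), (0,1)}` of the directed diamond
digraph, as a subset of `G_n = ZMod (2^n) × ZMod (2^n)`. -/
def Tplus (n : ℕ) : Set (ZMod (2 ^ n) × ZMod (2 ^ n)) :=
  {(1, 1), (1, 0), (0, 1)}

/-- Directed distance from `(0,0)` to `v` in the Cayley digraph `DT⃗_n = Γ(G_n, T⁺)`:
the least length of a list of elements of `T⁺` (repetitions allowed) summing to `v`. -/
noncomputable def ddistD (n : ℕ) (v : ZMod (2 ^ n) × ZMod (2 ^ n)) : ℕ :=
  sInf {k | ∃ l : List (ZMod (2 ^ n) × ZMod (2 ^ n)),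
    l.length = k ∧ (∀ s ∈ l, s ∈ Tplus n) ∧ l.sum = v}

/-- The oriented diameter of the directed diamond digraph `DT⃗_n`. -/
noncomputable def DvecD (n : ℕ) : ℕ := sSup (Set.range (ddistD n))

lemma val_one_le_aux (q : ℕ) : (1 : ZMod q).val ≤ 1 := by
  rw [ZMod.val_one_eq_one_mod]
  exact Nat.mod_le _ _

lemma list_bound_aux (n : ℕ) (l : List (ZMod (2 ^ n) × ZMod (2 ^ n)))
    (h : ∀ s ∈ l, s ∈ Tplus n) :
    l.sum.1.val ≤ l.length ∧ l.sum.2.val ≤ l.length := by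
  induction l with
  | nil => simp
  | cons x t ih =>
    obtain ⟨h1, h2⟩ := ih (fun s hs => h s (List.mem_cons_of_mem _ hs))
    have hx := h x List.mem_cons_self
    have key : x.1.val ≤ 1 ∧ x.2.val ≤ 1 := by
      have := val_one_le_aux (2 ^ n)
      simp only [Tplus, Set.mem_insert_iff, Set.mem_singleton_iff] at hx
      rcases hx with rfl | rfl | rfl <;> simp [this]
    have a1 := ZMod.val_add_le x.1 t.sum.1
    have a2 := ZMod.val_add_le x.2 t.sum.2
    simp only [List.sum_cons, List.length_cons, Prod.fst_add, Prod.snd_add]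
    omega

lemma ddistD_eq_aux (n : ℕ) (v : ZMod (2 ^ n) × ZMod (2 ^ n)) :
    ddistD n v = max v.1.val v.2.val := by
  unfold ddistD
  apply IsLeast.csInf_eq
  constructor
  · refine ⟨List.replicate (min v.1.val v.2.val) (1, 1)
      ++ List.replicate (v.1.val - v.2.val) (1, 0)
      ++ List.replicate (v.2.val - v.1.val) (0, 1), ?_, ?_, ?_⟩
    · simp only [List.length_append, List.length_replicate]
      omega
    · intro s hs
      simp only [List.mem_append, List.mem_replicate] at hs
      simp only [Tplus, Set.mem_insert_iff, Set.mem_singleton_iff]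
      tauto
    · have e1 : min v.1.val v.2.val + (v.1.val - v.2.val) = v.1.val := by omega
      have e2 : min v.1.val v.2.val + (v.2.val - v.1.val) = v.2.val := by omega
      have c1 := congrArg (Nat.cast : ℕ → ZMod (2 ^ n)) e1
      have c2 := congrArg (Nat.cast : ℕ → ZMod (2 ^ n)) e2
      rw [Nat.cast_add, ZMod.natCast_zmod_val] at c1 c2
      simp only [List.sum_append, List.sum_replicate]
      ext
      · simpa using c1
      · simpa using c2
  · rintro k ⟨l, rfl, hl, rfl⟩
    exact max_le (list_bound_aux n l hl).1 (list_bound_aux n l hl).2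

lemma val_eq_aux (n : ℕ) (a : ZMod (2 ^ n)) : a.val = 2 ^ n - 1 ↔ a = -1 := by
  have h : ((2 ^ n - 1 : ℕ) : ZMod (2 ^ n)) = -1 := by
    rw [Nat.cast_sub Nat.one_le_two_pow, ZMod.natCast_self]
    simp
  have hlt : 2 ^ n - 1 < 2 ^ n := Nat.sub_lt (by positivity) one_pos
  constructor
  · intro ha
    rw [← h, ← ha, ZMod.natCast_zmod_val]
  · rintro rfl
    rw [← h, ZMod.val_natCast_of_lt hlt]

/-- For every `n`, exactly `2^{n+1} - 1` elements of `G_n` have directed distance from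
`(0,0)` in the directed diamond `DT⃗_n` equal to the oriented diameter `2^n - 1`. -/
theorem directed_diamond_antipodal_count (n : ℕ) :
    {v : ZMod (2 ^ n) × ZMod (2 ^ n) |
      ddistD n v = 2 ^ n - 1}.ncard = 2 ^ (n + 1) - 1 := by
  have hs : {v : ZMod (2 ^ n) × ZMod (2 ^ n) | ddistD n v = 2 ^ n - 1}
      = ({-1} ×ˢ Set.univ) ∪ (Set.univ ×ˢ {-1}) := by
    ext v
    have h1 := ZMod.val_lt v.1
    have h2 := ZMod.val_lt v.2
    simp only [Set.mem_ofPred_eq, ddistD_eq_aux, Set.mem_union, Set.mem_prod,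
      Set.mem_singleton_iff, Set.mem_univ, and_true, true_and, ← val_eq_aux]
    omega
  have hi : (({-1} ×ˢ Set.univ) ∩ (Set.univ ×ˢ {-1}) :
      Set (ZMod (2 ^ n) × ZMod (2 ^ n))) = {(-1, -1)} := by
    ext v
    simp [Prod.ext_iff]
  have := Set.ncard_union_add_ncard_inter
    (({-1} : Set (ZMod (2 ^ n))) ×ˢ (Set.univ : Set (ZMod (2 ^ n)))) (Set.univ ×ˢ {-1})
  rw [hi, ← hs, Set.ncard_prod, Set.ncard_prod, Set.ncard_univ, Nat.card_zmod,
    Set.ncard_singleton, Set.ncard_singleton] at this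
  rw [pow_succ]
  omega
end
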